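/- With ψ_{(t,n,l)}: H_n^t → H_n^{t+2}∧(z*)^{l−1}, α ↦ α∧τ_{(n,l)}, the kernel dimension satisfies dim ker ψ_{(t,n,l)} = ∑_{i=1}^{⌊t/2⌋} (−1)^{i−1} (dim H_n^{t−2i} − δ_{t−2i,n}) + δ_{t,n} for every integer t, where dim H_n^q = ∑_{p=0}^q (n choose q−p)(n+p−1 choose p). -/

import Mathlib

noncomputable section

open TensorAlgebra

variable (F : Type) [Field F]

/-- The defining relations of the super-exterior algebra of the superspace `M₀ × M₁`
(`M₀` even, `M₁` odd): `u ⊗ v + (-1)^{|u||v|} v ⊗ u = 0`. -/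
inductive SRel (M₀ M₁ : Type) [AddCommGroup M₀] [Module F M₀] [AddCommGroup M₁] [Module F M₁] :
    TensorAlgebra F (M₀ × M₁) → TensorAlgebra F (M₀ × M₁) → Prop
  | ee (u v : M₀) : SRel M₀ M₁ (ι F (u, (0 : M₁)) * ι F (v, (0 : M₁)))
      (-(ι F (v, (0 : M₁)) * ι F (u, (0 : M₁))))
  | eo (u : M₀) (v : M₁) : SRel M₀ M₁ (ι F (u, (0 : M₁)) * ι F ((0 : M₀), v))
      (-(ι F ((0 : M₀), v) * ι F (u, (0 : M₁))))
  | oo (u v : M₁) : SRel M₀ M₁ (ι F ((0 : M₀), u) * ι F ((0 : M₀), v))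
      (ι F ((0 : M₀), v) * ι F ((0 : M₀), u))

variable (M₀ M₁ : Type) [AddCommGroup M₀] [Module F M₀] [AddCommGroup M₁] [Module F M₁]

/-- The super-exterior algebra `Λ̄(M₀ ⊕ M₁)`. -/
abbrev SExt : Type := RingQuot (SRel F M₀ M₁)

/-- The canonical image of an even vector. -/
def genE (u : M₀) : SExt F M₀ M₁ := RingQuot.mkAlgHom F (SRel F M₀ M₁) (ι F (u, (0 : M₁)))

/-- The canonical image of an odd vector. -/
def genO (v : M₁) : SExt F M₀ M₁ := RingQuot.mkAlgHom F (SRel F M₀ M₁) (ι F ((0 : M₀), v))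

/-- The monomial associated with a list of (even or odd) vectors. -/
def mon (l : List (M₀ ⊕ M₁)) : SExt F M₀ M₁ :=
  (l.map (Sum.elim (genE F M₀ M₁) (genO F M₀ M₁))).prod

/-- The `ℤ`-degree-`q` component `Λ̄^q` of the super-exterior algebra. -/
def sdeg (q : ℕ) : Submodule F (SExt F M₀ M₁) :=
  Submodule.span F {x | ∃ l : List (M₀ ⊕ M₁), l.length = q ∧ x = mon F M₀ M₁ l}

/-- The `ℤ₂`-homogeneous component of parity `ε` of the super-exterior algebra. -/
def sparity (ε : Bool) : Submodule F (SExt F M₀ M₁) :=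
  Submodule.span F {x | ∃ l : List (M₀ ⊕ M₁),
    l.countP Sum.isRight % 2 = (if ε then 1 else 0) ∧ x = mon F M₀ M₁ l}

/-- `D` satisfies the Leibniz rule of an exterior superderivation of
`ℤ×ℤ₂`-degree `(1, 0̄)`:  `D(μ∧ν) = Dμ∧ν + (-1)^‖μ‖ μ∧Dν`. -/
def IsLeib (D : SExt F M₀ M₁ →ₗ[F] SExt F M₀ M₁) : Prop :=
  ∀ (q : ℕ) (x : SExt F M₀ M₁), x ∈ sdeg F M₀ M₁ q → ∀ y : SExt F M₀ M₁,
    D (x * y) = D x * y + ((-1 : F) ^ q) • (x * D y)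

/-- `D` raises the `ℤ`-degree by one. -/
def RaisesDeg (D : SExt F M₀ M₁ →ₗ[F] SExt F M₀ M₁) : Prop :=
  ∀ (q : ℕ) (x : SExt F M₀ M₁), x ∈ sdeg F M₀ M₁ q → D x ∈ sdeg F M₀ M₁ (q + 1)

/-- `D` has `ℤ₂`-degree `0̄`. -/
def KeepsParity (D : SExt F M₀ M₁ →ₗ[F] SExt F M₀ M₁) : Prop :=
  ∀ (ε : Bool) (x : SExt F M₀ M₁), x ∈ sparity F M₀ M₁ ε → D x ∈ sparity F M₀ M₁ ε

open Module

variable (n : ℕ)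

/-- The even part of `𝔥_n`: the span of `x₁,…,x_n`. -/
abbrev KV₀ : Type := Fin n → F

/-- The odd part of `𝔥_n`: the span of `y₁,…,y_n` and the central `z` (last coordinate). -/
abbrev KV₁ : Type := Fin (n + 1) → F

/-- The bracket of the Heisenberg Lie superalgebra `𝔥_n` with odd center: `[x_i, y_i] = z`. -/
def kBr (a b : KV₀ F n × KV₁ F n) : KV₀ F n × KV₁ F n :=
  (0, Pi.single (Fin.last n)
    (∑ i : Fin n, (a.1 i * b.2 i.castSucc - b.1 i * a.2 i.castSucc)))

/-- The cochain algebra `Λ̄ 𝔥_n*`. -/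
abbrev KC : Type := SExt F (Dual F (KV₀ F n)) (Dual F (KV₁ F n))

/-- The dual basis vector `e_i` (even). -/
def kE (i : Fin n) : KC F n :=
  genE F (Dual F (KV₀ F n)) (Dual F (KV₁ F n)) (LinearMap.proj i)

/-- The dual basis vector `o_j` (odd). -/
def kO (j : Fin n) : KC F n :=
  genO F (Dual F (KV₀ F n)) (Dual F (KV₁ F n)) (LinearMap.proj j.castSucc)

/-- The dual `z*` of the odd center (odd). -/
def kZ : KC F n :=
  genO F (Dual F (KV₀ F n)) (Dual F (KV₁ F n)) (LinearMap.proj (Fin.last n))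

/-- `τ_{(n,1)} = ∑ o_i ∧ e_i`. -/
def kTau : KC F n := ∑ i : Fin n, kO F n i * kE F n i

/-- `τ_{(n,l)} = l τ_{(n,1)} ∧ (z*)^{l−1}`. -/
def kTauL (l : ℕ) : KC F n := (l : F) • (kTau F n * kZ F n ^ (l - 1))

/-- `H_n^q`: the degree-`q` part of `Λ̄ V` for `V` the span of `e₁,…,e_n, o₁,…,o_n`
(the dual vectors other than `z*`, i.e. odd functionals vanishing on `z`). -/
def Hn (q : ℕ) : Submodule F (KC F n) :=
  Submodule.span F {x | ∃ l : List (Dual F (KV₀ F n) ⊕ Dual F (KV₁ F n)),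
    l.length = q ∧
    (∀ h : Dual F (KV₁ F n), Sum.inr h ∈ l → h (Pi.single (Fin.last n) 1) = 0) ∧
    x = mon F (Dual F (KV₀ F n)) (Dual F (KV₁ F n)) l}

/-- The top exterior monomial `e₁ ∧ ⋯ ∧ e_n`. -/
def kTop : KC F n :=
  mon F (Dual F (KV₀ F n)) (Dual F (KV₁ F n))
    (List.ofFn fun i : Fin n => Sum.inl (LinearMap.proj i))

/-- `D` is the differential of the cochain complex of `𝔥_n`: the degree-one superderivation
with `D e_i = 0`, `D o_j = 0` and `D z* = τ_{(n,1)} = ∑ o_i ∧ e_i` (equivalently,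
`D h = h(z) • τ` for every odd functional `h`). -/
def IsDiffN (D : KC F n →ₗ[F] KC F n) : Prop :=
  RaisesDeg F (Dual F (KV₀ F n)) (Dual F (KV₁ F n)) D ∧
  IsLeib F (Dual F (KV₀ F n)) (Dual F (KV₁ F n)) D ∧
  (∀ f : Dual F (KV₀ F n), D (genE F (Dual F (KV₀ F n)) (Dual F (KV₁ F n)) f) = 0) ∧
  (∀ h : Dual F (KV₁ F n),
    D (genO F (Dual F (KV₀ F n)) (Dual F (KV₁ F n)) h) =
      h (Pi.single (Fin.last n) 1) • kTau F n)

/-- The space of `q`-cocycles of `𝔥_n`. -/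
def Zn (D : KC F n →ₗ[F] KC F n) (q : ℕ) : Submodule F (KC F n) :=
  sdeg F (Dual F (KV₀ F n)) (Dual F (KV₁ F n)) q ⊓ LinearMap.ker D

/-- `dim H_n^q = ∑_{p=0}^q (n choose q−p)(n+p−1 choose p)`. -/
def dimHn (n q : ℕ) : ℕ :=
  ∑ p ∈ Finset.range (q + 1), n.choose (q - p) * (n + p - 1).choose p

set_option linter.style.haveILetI false
set_option linter.unusedSimpArgs false
set_option linter.unusedSectionVars false

/-! ### The concrete model -/

/-- The exterior algebra on the even generators. -/
abbrev XL : Type := ExteriorAlgebra F (Dual F (KV₀ F n))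

/-- The concrete model: polynomials in the odd generators with exterior coefficients. -/
abbrev XM : Type := (Fin (n + 1) →₀ ℕ) →₀ XL F n

/-- Grade involution. -/
def xinv : XL F n →ₗ[F] XL F n :=
  (CliffordAlgebra.involute (Q := (0 : QuadraticForm F (Dual F (KV₀ F n))))).toLinearMap

/-- Even generators in the exterior algebra. -/
def xi (u : Dual F (KV₀ F n)) : XL F n := ExteriorAlgebra.ι F u

lemma xinv_mul (x y : XL F n) : xinv F n (x * y) = xinv F n x * xinv F n y := by
  simp [xinv]

lemma xinv_one : xinv F n 1 = 1 := by
  simp [xinv]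

lemma xinv_xi (u) : xinv F n (xi F n u) = - xi F n u := by
  simp [xinv, xi]

lemma xinv_xinv (x) : xinv F n (xinv F n x) = x := by
  simp [xinv]

lemma xi_anti (u v) : xi F n u * xi F n v = - (xi F n v * xi F n u) := by
  have := ExteriorAlgebra.ι_add_mul_swap (R := F) u v
  exact eq_neg_of_add_eq_zero_left this

lemma XL_induction {p : XL F n → Prop} (h1 : ∀ c : F, p (algebraMap F _ c))
    (hadd : ∀ x y, p x → p y → p (x + y)) (hm : ∀ x u, p x → p (x * xi F n u)) (x) : p x := by
  refine CliffordAlgebra.right_induction (Q := (0 : QuadraticForm F (Dual F (KV₀ F n)))) (P := p) h1 hadd ?_ x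
  intro m x hx
  exact hm x m hx

/-- Right multiplication by an even generator. -/
def xE (u : Dual F (KV₀ F n)) : XM F n →ₗ[F] XM F n :=
  Finsupp.mapRange.linearMap (LinearMap.mulRight F (xi F n u))

/-- Right multiplication by an odd generator. -/
def xO (j : Fin (n + 1)) : XM F n →ₗ[F] XM F n :=
  Finsupp.lmapDomain (XL F n) F (fun a => a + Finsupp.single j 1) ∘ₗ
    Finsupp.mapRange.linearMap (xinv F n)

/-- Right multiplication by an odd vector. -/
def xOh (h : Dual F (KV₁ F n)) : XM F n →ₗ[F] XM F n :=
  ∑ j, h (Pi.single j 1) • xO F n j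

lemma xE_single (u a w) : xE F n u (Finsupp.single a w) = Finsupp.single a (w * xi F n u) := by
  simp [xE]

lemma xO_single (j a w) : xO F n j (Finsupp.single a w) =
    Finsupp.single (a + Finsupp.single j 1) (xinv F n w) := by
  simp [xO]

lemma xE_add (u v) : xE F n (u + v) = xE F n u + xE F n v := by
  apply Finsupp.lhom_ext
  intro a w
  simp [xE_single, xi, mul_add]

lemma xE_smul (c : F) (u) : xE F n (c • u) = c • xE F n u := by
  apply Finsupp.lhom_ext
  intro a w
  rw [LinearMap.smul_apply, xE_single, xE_single, Finsupp.smul_single]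
  simp [xi]

lemma xE_xE (u v) : xE F n u * xE F n v = - (xE F n v * xE F n u) := by
  apply Finsupp.lhom_ext
  intro a w
  simp only [Module.End.mul_apply, xE_single, LinearMap.neg_apply, ← Finsupp.single_neg, mul_assoc]
  rw [xi_anti, mul_neg]

lemma xO_xE (u j) : xO F n j * xE F n u = - (xE F n u * xO F n j) := by
  apply Finsupp.lhom_ext
  intro a w
  simp only [Module.End.mul_apply, xE_single, xO_single, LinearMap.neg_apply, ← Finsupp.single_neg,
    xinv_mul, xinv_xi, mul_neg]

lemma xO_xO (i j) : xO F n j * xO F n i = xO F n i * xO F n j := by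
  apply Finsupp.lhom_ext
  intro a w
  simp only [Module.End.mul_apply, xO_single, add_right_comm]

lemma anti_sum_aux {ι A : Type} [Fintype ι] [Ring A] [Algebra F A] (c : ι → F) (B : ι → A) (x : A)
    (h : ∀ j, B j * x = - (x * B j)) : (∑ j, c j • B j) * x = - (x * ∑ j, c j • B j) := by
  simp [Finset.sum_mul, Finset.mul_sum, h]

lemma xOh_xE (u h) : xOh F n h * xE F n u = - (xE F n u * xOh F n h) :=
  anti_sum_aux F (fun j => h (Pi.single j 1)) (fun j => xO F n j) (xE F n u)
    (fun j => xO_xE F n u j)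

lemma xOh_xOh (h h') : xOh F n h * xOh F n h' = xOh F n h' * xOh F n h := by
  simp only [xOh, Finset.sum_mul, Finset.mul_sum]
  rw [Finset.sum_comm]
  refine Finset.sum_congr rfl fun i _ => Finset.sum_congr rfl fun j _ => ?_
  simp only [smul_mul_assoc, mul_smul_comm]
  rw [xO_xO, smul_comm]

/-- The generator map of the right regular representation. -/
def xgen : (Dual F (KV₀ F n) × Dual F (KV₁ F n)) →ₗ[F] (Module.End F (XM F n))ᵐᵒᵖ where
  toFun p := MulOpposite.op (xE F n p.1 + xOh F n p.2)
  map_add' p q := by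
    rw [← MulOpposite.op_add]
    congr 1
    simp only [Prod.fst_add, Prod.snd_add, xE_add, xOh, LinearMap.add_apply, add_smul,
      Finset.sum_add_distrib]
    abel
  map_smul' c p := by
    rw [RingHom.id_apply, ← MulOpposite.op_smul]
    congr 1
    simp only [Prod.smul_fst, Prod.smul_snd, xE_smul, xOh, LinearMap.smul_apply, smul_add,
      Finset.smul_sum, smul_smul, smul_eq_mul]

/-- The right regular representation. -/
def xrho : KC F n →ₐ[F] (Module.End F (XM F n))ᵐᵒᵖ :=
  RingQuot.liftAlgHom F ⟨TensorAlgebra.lift F (xgen F n), by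
    intro x y h
    have h0 : xE F n 0 = 0 := by simpa using xE_smul F n 0 0
    have h1 : xOh F n 0 = 0 := by simp [xOh]
    cases h with
    | ee u v =>
      simp only [map_mul, map_neg, TensorAlgebra.lift_ι_apply, xgen, LinearMap.coe_mk,
        AddHom.coe_mk, h0, h1, zero_add, add_zero, ← MulOpposite.op_mul, ← MulOpposite.op_neg]
      rw [xE_xE]
    | eo u v =>
      simp only [map_mul, map_neg, TensorAlgebra.lift_ι_apply, xgen, LinearMap.coe_mk,
        AddHom.coe_mk, h0, h1, zero_add, add_zero, ← MulOpposite.op_mul, ← MulOpposite.op_neg]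
      rw [xOh_xE]
    | oo u v =>
      simp only [map_mul, map_neg, TensorAlgebra.lift_ι_apply, xgen, LinearMap.coe_mk,
        AddHom.coe_mk, h0, h1, zero_add, add_zero, ← MulOpposite.op_mul, ← MulOpposite.op_neg]
      rw [xOh_xOh]⟩

/-- Action of an element by right multiplication on the model. -/
def xact (x : KC F n) : XM F n →ₗ[F] XM F n := (xrho F n x).unop

/-- Even generator. -/
abbrev gE (u : Dual F (KV₀ F n)) : KC F n := genE F (Dual F (KV₀ F n)) (Dual F (KV₁ F n)) u
/-- Odd generator. -/
abbrev gO (u : Dual F (KV₁ F n)) : KC F n := genO F (Dual F (KV₀ F n)) (Dual F (KV₁ F n)) u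

lemma xact_mul (x y f) : xact F n (x * y) f = xact F n y (xact F n x f) := by
  simp [xact]

lemma xact_one (f) : xact F n 1 f = f := by
  simp [xact]

lemma xact_add (x y f) : xact F n (x + y) f = xact F n x f + xact F n y f := by
  simp [xact]

lemma xact_smul (c : F) (x f) : xact F n (c • x) f = c • xact F n x f := by
  simp [xact]

lemma xact_gE (u) : xact F n (gE F n u) = xE F n u := by
  have h1 : xOh F n 0 = 0 := by simp [xOh]
  simp [xact, genE, xrho, xgen, h1]

lemma xact_gO (u) : xact F n (gO F n u) = xOh F n u := by
  have h0 : xE F n 0 = 0 := by simpa using xE_smul F n 0 0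
  simp [xact, genO, xrho, xgen, h0]

lemma KC_induction {p : KC F n → Prop} (h1 : ∀ c : F, p (algebraMap F _ c))
    (hadd : ∀ x y, p x → p y → p (x + y)) (hm : ∀ x y, p x → p y → p (x * y))
    (hE : ∀ u, p (gE F n u)) (hO : ∀ u, p (gO F n u)) (x) : p x := by
  obtain ⟨b, rfl⟩ := RingQuot.mkAlgHom_surjective F _ x
  induction b using TensorAlgebra.induction with
  | algebraMap r => simpa using h1 r
  | ι v =>
    have : v = (v.1, 0) + (0, v.2) := by simp
    rw [this, map_add, map_add]
    exact hadd _ _ (hE v.1) (hO v.2)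
  | mul a b ha hb => rw [map_mul]; exact hm _ _ ha hb
  | add a b ha hb => rw [map_add]; exact hadd _ _ ha hb

lemma gO_comm (u v) : gO F n u * gO F n v = gO F n v * gO F n u := by
  simpa [genO] using RingQuot.mkAlgHom_rel F (SRel.oo (F := F) (M₀ := Dual F (KV₀ F n)) u v)

lemma gE_gO (u v) : gE F n u * gO F n v = - (gO F n v * gE F n u) := by
  simpa [genO, genE] using RingQuot.mkAlgHom_rel F (SRel.eo (F := F) u v)

lemma gE_gE (u v) : gE F n u * gE F n v = - (gE F n v * gE F n u) := by
  simpa [genO, genE] using RingQuot.mkAlgHom_rel F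
    (SRel.ee (F := F) (M₁ := Dual F (KV₁ F n)) u v)

/-- `gE` as a linear map. -/
def gEl : Dual F (KV₀ F n) →ₗ[F] KC F n :=
  (RingQuot.mkAlgHom F (SRel F (Dual F (KV₀ F n)) (Dual F (KV₁ F n)))).toLinearMap ∘ₗ
    TensorAlgebra.ι F ∘ₗ LinearMap.inl F _ _

/-- `gO` as a linear map. -/
def gOl : Dual F (KV₁ F n) →ₗ[F] KC F n :=
  (RingQuot.mkAlgHom F (SRel F (Dual F (KV₀ F n)) (Dual F (KV₁ F n)))).toLinearMap ∘ₗ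
    TensorAlgebra.ι F ∘ₗ LinearMap.inr F _ _

lemma gEl_apply (u) : gEl F n u = gE F n u := rfl
lemma gOl_apply (u) : gOl F n u = gO F n u := rfl

/-- Basis odd generators. -/
def gj (j : Fin (n + 1)) : KC F n := gO F n (LinearMap.proj j)

lemma gO_eq_sum (h) : gO F n h = ∑ j, h (Pi.single j 1) • gj F n j := by
  have : h = ∑ j, h (Pi.single j 1) • (LinearMap.proj j : Dual F (KV₁ F n)) := by
    apply LinearMap.pi_ext'
    intro i
    ext
    simp [Pi.single_apply, Finset.sum_ite_eq]
  conv_lhs => rw [this, ← gOl_apply, map_sum]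
  simp [gOl_apply, gj]

lemma xact_gj (j) : xact F n (gj F n j) = xO F n j := by
  rw [gj, xact_gO, xOh, Finset.sum_eq_single j]
  · simp
  · intro b _ hb
    simp [Pi.single_apply, hb.symm]
  · simp

lemma exists_monomials {ι A : Type} [Monoid A] (g : ι → A) (hg : ∀ i j, g i * g j = g j * g i) :
    ∃ P : (ι →₀ ℕ) → A, P 0 = 1 ∧ ∀ a j, P (a + Finsupp.single j 1) = P a * g j := by
  classical
  have hc := Submonoid.isMulCommutative_closure A (s := Set.range g) (by
    rintro _ ⟨i, rfl⟩ _ ⟨j, rfl⟩; exact hg i j)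
  letI : CommMonoid (Submonoid.closure (Set.range g)) :=
    { (inferInstance : Monoid (Submonoid.closure (Set.range g))) with
      mul_comm := fun a b => hc.is_comm.comm a b }
  let g' : ι → Submonoid.closure (Set.range g) := fun i =>
    ⟨g i, Submonoid.subset_closure ⟨i, rfl⟩⟩
  refine ⟨fun a => ((a.prod fun j k => g' j ^ k : Submonoid.closure (Set.range g)) : A), ?_, ?_⟩
  · simp
  · intro a j
    change ((Finsupp.prod _ _ : Submonoid.closure (Set.range g)) : A) = _
    rw [Finsupp.prod_add_index' (by intros; simp) (by intros; rw [pow_add]),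
      Finsupp.prod_single_index (by simp), pow_one]
    rfl

/-- Ordered monomials in the odd generators. -/
def xP : (Fin (n + 1) →₀ ℕ) → KC F n :=
  (exists_monomials (gj F n) (fun _ _ => gO_comm F n _ _)).choose

lemma xP_zero : xP F n 0 = 1 :=
  (exists_monomials (gj F n) (fun _ _ => gO_comm F n _ _)).choose_spec.1

lemma xP_succ (a j) : xP F n (a + Finsupp.single j 1) = xP F n a * gj F n j :=
  (exists_monomials (gj F n) (fun _ _ => gO_comm F n _ _)).choose_spec.2 a j

lemma exp_induction {m : ℕ} {p : (Fin m →₀ ℕ) → Prop} (h0 : p 0)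
    (hs : ∀ a j, p a → p (a + Finsupp.single j 1)) (a) : p a := by
  induction a using Finsupp.induction_linear with
  | zero => exact h0
  | add f g hf hg =>
    clear hg
    induction g using Finsupp.induction with
    | zero => simpa
    | single_add i b f' _ _ ih =>
      rw [add_comm (Finsupp.single i b), ← add_assoc]
      clear * - ih hs
      induction b with
      | zero => simpa
      | succ b ihb => rw [Finsupp.single_add, ← add_assoc]; exact hs _ _ ihb
  | single i b =>
    induction b with
    | zero => simpa
    | succ b ihb => rw [Finsupp.single_add]; exact hs _ _ ihb

section
variable [CharZero F]

/-- The embedding of the exterior algebra. -/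
def xlift : XL F n →ₐ[F] KC F n :=
  ExteriorAlgebra.lift F ⟨gEl F n, fun u => by
    have := gE_gE F n u u
    rw [gEl_apply]
    rw [eq_neg_iff_add_eq_zero, ← two_smul F] at this
    exact (smul_eq_zero.mp this).resolve_left two_ne_zero⟩

lemma xlift_xi (u) : xlift F n (xi F n u) = gE F n u := by
  simp [xlift, xi, gEl_apply]

lemma xlift_gj (w j) : xlift F n w * gj F n j = gj F n j * xlift F n (xinv F n w) := by
  induction w using XL_induction with
  | h1 c =>
    have : xinv F n (algebraMap F _ c) = algebraMap F _ c := by simp [xinv]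
    rw [this, AlgHom.commutes, Algebra.commutes]
  | hadd x y hx hy => simp only [map_add, add_mul, mul_add, hx, hy]
  | hm x u hx =>
    rw [xinv_mul, xinv_xi, mul_neg, map_neg, map_mul, map_mul, xlift_xi, mul_assoc]
    have key : ∀ (a b : KC F n), a * -b = -(a * b) := fun a b => mul_neg a b
    have h2 : gE F n u * gj F n j = - (gj F n j * gE F n u) := gE_gO F n _ _
    rw [h2, key, key, ← mul_assoc, hx, mul_assoc]

/-- The inverse map from the model. -/
def xpsi : XM F n →ₗ[F] KC F n :=
  Finsupp.lsum F fun a => LinearMap.mulLeft F (xP F n a) ∘ₗ (xlift F n).toLinearMap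

lemma xpsi_single (a w) : xpsi F n (Finsupp.single a w) = xP F n a * xlift F n w := by
  simp [xpsi]

lemma xpsi_xE (u f) : xpsi F n (xE F n u f) = xpsi F n f * gE F n u := by
  induction f using Finsupp.induction_linear with
  | zero => simp
  | add f g hf hg => simp only [map_add, hf, hg, add_mul]
  | single a w => rw [xE_single, xpsi_single, xpsi_single, map_mul, xlift_xi, mul_assoc]

lemma xpsi_xO (j f) : xpsi F n (xO F n j f) = xpsi F n f * gj F n j := by
  induction f using Finsupp.induction_linear with
  | zero => simp
  | add f g hf hg => simp only [map_add, hf, hg, add_mul]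
  | single a w => rw [xO_single, xpsi_single, xpsi_single, xP_succ, mul_assoc, mul_assoc, xlift_gj]

lemma xpsi_xact (x f) : xpsi F n (xact F n x f) = xpsi F n f * x := by
  induction x using KC_induction generalizing f with
  | h1 c => simp [Algebra.algebraMap_eq_smul_one, xact_smul, xact_one]
  | hadd x y hx hy => simp [xact_add, mul_add, hx, hy]
  | hm x y hx hy => rw [xact_mul, hy, hx, mul_assoc]
  | hE u => rw [xact_gE, xpsi_xE]
  | hO h =>
    rw [xact_gO, xOh, gO_eq_sum]
    simp [LinearMap.sum_apply, xpsi_xO, Finset.mul_sum]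

/-- The identification with the model. -/
def xphi : KC F n →ₗ[F] XM F n where
  toFun x := xact F n x (Finsupp.single 0 1)
  map_add' x y := xact_add F n x y _
  map_smul' c x := xact_smul F n c x _

lemma xphi_mul (x y) : xphi F n (x * y) = xact F n y (xphi F n x) := xact_mul F n x y _

lemma xpsi_xphi (x) : xpsi F n (xphi F n x) = x := by
  change xpsi F n (xact F n x _) = x
  rw [xpsi_xact, xpsi_single, xP_zero, map_one, one_mul, one_mul]

lemma xact_xlift (w a x) : xact F n (xlift F n w) (Finsupp.single a x) = Finsupp.single a (x * w) := by
  induction w using XL_induction generalizing x with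
  | h1 c =>
    simp [Algebra.algebraMap_eq_smul_one, xact_smul, xact_one]
  | hadd y z hy hz => simp [xact_add, mul_add, hy, hz]
  | hm y u hy => rw [map_mul, xact_mul, hy, xlift_xi, xact_gE, xE_single, mul_assoc]

lemma xact_xP (a) : xact F n (xP F n a) (Finsupp.single 0 1) = Finsupp.single a 1 := by
  induction a using exp_induction with
  | h0 => rw [xP_zero, xact_one]
  | hs a j ih => rw [xP_succ, xact_mul, ih, xact_gj, xO_single, xinv_one]

lemma xphi_xpsi (f) : xphi F n (xpsi F n f) = f := by
  induction f using Finsupp.induction_linear with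
  | zero => simp
  | add f g hf hg => simp only [map_add, hf, hg]
  | single a w =>
    rw [xpsi_single, xphi_mul]
    change xact F n _ (xact F n _ _) = _
    rw [xact_xP, xact_xlift, one_mul]

end

/-! ### Gradings -/

/-- The degree `k` part of the exterior algebra (`k` an integer). -/
def xG (k : ℤ) : Submodule F (XL F n) :=
  if 0 ≤ k then ⋀[F]^(k.toNat) (Dual F (KV₀ F n)) else ⊥

lemma xG_nat (k : ℕ) : xG F n k = ⋀[F]^k (Dual F (KV₀ F n)) := by
  simp [xG]

lemma xG_neg {k : ℤ} (hk : k < 0) : xG F n k = ⊥ := by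
  simp [xG, hk]

lemma xG_xi {k : ℤ} {w} (hw : w ∈ xG F n k) (u) : w * xi F n u ∈ xG F n (k + 1) := by
  rcases lt_or_ge k 0 with hk | hk
  · rw [xG_neg F n hk] at hw
    rw [(Submodule.mem_bot F).mp hw, zero_mul]
    exact Submodule.zero_mem _
  · lift k to ℕ using hk
    have : ((k : ℤ) + 1) = ((k + 1 : ℕ) : ℤ) := by simp
    rw [this, xG_nat, ExteriorAlgebra.exteriorPower, pow_succ]
    rw [xG_nat] at hw
    exact Submodule.mul_mem_mul hw ⟨u, rfl⟩

lemma xG_ind {p : ℤ → XL F n → Prop} (h0 : ∀ k, p k 0) (h1 : ∀ c : F, p 0 (algebraMap F _ c))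
    (hadd : ∀ k x y, p k x → p k y → p k (x + y))
    (hmul : ∀ k w u, w ∈ xG F n k → p k w → p (k + 1) (w * xi F n u))
    {k : ℤ} {w} (hw : w ∈ xG F n k) : p k w := by
  rcases lt_or_ge k 0 with hk | hk
  · rw [xG_neg F n hk] at hw
    rw [(Submodule.mem_bot F).mp hw]
    exact h0 _
  · lift k to ℕ using hk
    rw [xG_nat] at hw
    refine Submodule.pow_induction_on_right' (M := LinearMap.range (ExteriorAlgebra.ι F))
      (C := fun (m : ℕ) x _ => p m x) ?_ ?_ ?_ hw
    · intro r; exact h1 r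
    · intro x y i _ _ hx hy; exact hadd _ _ _ hx hy
    · rintro i x hx hp _ ⟨u, rfl⟩
      have := hmul i x u (by rw [xG_nat]; exact hx) hp
      have e : ((i : ℤ) + 1) = ((i.succ : ℕ) : ℤ) := by simp
      rw [e] at this
      exact this

lemma xinv_mem {k : ℤ} {w} (hw : w ∈ xG F n k) : xinv F n w ∈ xG F n k := by
  refine xG_ind F n (p := fun k w => xinv F n w ∈ xG F n k) ?_ ?_ ?_ ?_ hw
  · intro k; simp
  · intro c
    have : xinv F n (algebraMap F _ c) = algebraMap F _ c := by simp [xinv]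
    rw [this]
    have := xG_nat F n 0
    simp only [Nat.cast_zero] at this
    rw [this, ExteriorAlgebra.exteriorPower, pow_zero]
    exact Submodule.algebraMap_mem c
  · intro k x y hx hy; rw [map_add]; exact add_mem hx hy
  · intro k w u _ hw
    rw [xinv_mul, xinv_xi, mul_neg]
    exact neg_mem (xG_xi F n hw u)

/-- Contraction. -/
def xC (i : Fin n) : XL F n →ₗ[F] XL F n :=
  (CliffordAlgebra.contractRight (Q := (0 : QuadraticForm F (Dual F (KV₀ F n))))).flip
    (Dual.eval F (KV₀ F n) (Pi.single i 1))

lemma xC_mul (i w u) : xC F n i (w * xi F n u) = u (Pi.single i 1) • w - xC F n i w * xi F n u := by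
  exact CliffordAlgebra.contractRight_mul_ι _ _ _

lemma xC_algebraMap (i) (c : F) : xC F n i (algebraMap F _ c) = 0 := by
  exact CliffordAlgebra.contractRight_algebraMap _ _ _

lemma xC_mem (i) {k : ℤ} {w} (hw : w ∈ xG F n k) : xC F n i w ∈ xG F n (k - 1) := by
  refine xG_ind F n (p := fun k w => xC F n i w ∈ xG F n (k - 1)) ?_ ?_ ?_ ?_ hw
  · intro k; simp
  · intro c; rw [xC_algebraMap]; exact Submodule.zero_mem _
  · intro k x y hx hy; rw [map_add]; exact add_mem hx hy
  · intro k w u hw hp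
    rw [xC_mul]
    refine sub_mem (Submodule.smul_mem _ _ ?_) ?_
    · simpa using hw
    · have := xG_xi F n hp u
      rw [sub_add_cancel] at this
      rwa [add_sub_cancel_right]

lemma xinv_xC (i w) : xinv F n (xC F n i w) = - xC F n i (xinv F n w) := by
  induction w using XL_induction with
  | h1 c =>
    have : xinv F n (algebraMap F _ c) = algebraMap F _ c := by simp [xinv]
    rw [this, xC_algebraMap]; simp
  | hadd x y hx hy => simp only [map_add, hx, hy]; abel
  | hm x u hx =>
    rw [xC_mul, map_sub, xinv_mul, xinv_mul, xinv_xi, hx, map_smul, mul_neg, mul_neg,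
      (xC F n i).map_neg, xC_mul]
    simp

lemma xi_sum (u : Dual F (KV₀ F n)) :
    ∑ i, u (Pi.single i 1) • xi F n (LinearMap.proj i) = xi F n u := by
  have : u = ∑ j, u (Pi.single j 1) • (LinearMap.proj j : Dual F (KV₀ F n)) := by
    apply LinearMap.pi_ext'
    intro i
    ext
    simp [Pi.single_apply]
  conv_rhs => rw [this]
  simp [xi]

lemma xN {k : ℤ} {w} (hw : w ∈ xG F n k) :
    ∑ i, xC F n i w * xi F n (LinearMap.proj i) = (k : F) • w := by
  refine xG_ind F n
    (p := fun k w => ∑ i, xC F n i w * xi F n (LinearMap.proj i) = (k : F) • w) ?_ ?_ ?_ ?_ hw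
  · intro k; simp
  · intro c; simp [xC_algebraMap]
  · intro k x y hx hy; simp only [map_add, add_mul, Finset.sum_add_distrib, hx, hy, smul_add]
  · intro k w u hw hp
    have h1 : ∀ i, xC F n i (w * xi F n u) * xi F n (LinearMap.proj i) =
        w * (u (Pi.single i 1) • xi F n (LinearMap.proj i)) +
          (xC F n i w * xi F n (LinearMap.proj i)) * xi F n u := by
      intro i
      rw [xC_mul, sub_mul, mul_assoc, xi_anti, mul_neg, sub_neg_eq_add, mul_assoc, smul_mul_assoc,
        mul_smul_comm]
    simp only [h1, Finset.sum_add_distrib]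
    rw [← Finset.mul_sum, ← Finset.sum_mul, xi_sum, hp]
    push_cast
    rw [add_smul, one_smul, smul_mul_assoc, add_comm]

lemma xG_finite (k : ℤ) : Module.Finite F (xG F n k) := by
  rcases lt_or_ge k 0 with hk | hk
  · rw [xG_neg F n hk]; infer_instance
  · lift k to ℕ using hk
    rw [xG_nat]; infer_instance

lemma xG_finrank (k : ℕ) : Module.finrank F (xG F n k) = n.choose k := by
  rw [xG_nat, exteriorPower.finrank_eq]
  simp

lemma xG_big {k : ℤ} (hk : (n : ℤ) < k) : xG F n k = ⊥ := by
  lift k to ℕ using by omega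
  have := xG_finite F n k
  rw [← Submodule.finrank_eq_zero (R := F), xG_finrank]
  exact Nat.choose_eq_zero_of_lt (by omega)

/-- The degree `t` part of the model (without the last odd variable). -/
def xMt (t : ℤ) : Submodule F (XM F n) where
  carrier := {f | ∀ a, f a ∈ xG F n (t - a.degree) ∧ (a (Fin.last n) ≠ 0 → f a = 0)}
  add_mem' := by
    intro f g hf hg a
    refine ⟨add_mem (hf a).1 (hg a).1, fun h => ?_⟩
    rw [Finsupp.add_apply, (hf a).2 h, (hg a).2 h, add_zero]
  zero_mem' := by intro a; simp
  smul_mem' := by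
    intro c f hf a
    refine ⟨Submodule.smul_mem _ _ (hf a).1, fun h => ?_⟩
    rw [Finsupp.smul_apply, (hf a).2 h, smul_zero]

lemma single_mem {t : ℤ} {a : Fin (n + 1) →₀ ℕ} {w} (ha : a (Fin.last n) = 0)
    (hw : w ∈ xG F n (t - a.degree)) : Finsupp.single a w ∈ xMt F n t := by
  intro b
  by_cases h : a = b
  · subst h
    simp [hw, ha]
  · simp [Finsupp.single_apply, h]

lemma xMt_ind {t : ℤ} (S : Submodule F (XM F n))
    (h : ∀ a w, a (Fin.last n) = 0 → w ∈ xG F n (t - a.degree) → Finsupp.single a w ∈ S) :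
    xMt F n t ≤ S := by
  intro f hf
  rw [← Finsupp.sum_single f]
  refine Submodule.sum_mem _ fun a _ => ?_
  by_cases ha : a (Fin.last n) = 0
  · exact h a _ ha (hf a).1
  · rw [(hf a).2 ha]; simp

lemma xE_mem {t : ℤ} {f} (hf : f ∈ xMt F n t) (u) : xE F n u f ∈ xMt F n (t + 1) := by
  refine xMt_ind F n ((xMt F n (t + 1)).comap (xE F n u)) ?_ hf
  intro a w ha hw
  rw [Submodule.mem_comap, xE_single]
  apply single_mem F n ha
  have := xG_xi F n hw u
  rwa [show t - (a.degree : ℤ) + 1 = t + 1 - a.degree by ring] at this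

lemma xO_mem {t : ℤ} {f} (hf : f ∈ xMt F n t) (j : Fin (n + 1)) (hj : j ≠ Fin.last n) :
    xO F n j f ∈ xMt F n (t + 1) := by
  refine xMt_ind F n ((xMt F n (t + 1)).comap (xO F n j)) ?_ hf
  intro a w ha hw
  rw [Submodule.mem_comap, xO_single]
  apply single_mem F n
  · simp [ha, hj]
  · have := xinv_mem F n hw
    rw [map_add, Finsupp.degree_single]
    rwa [show t + 1 - ((a.degree + 1 : ℕ) : ℤ) = t - a.degree by push_cast; ring]

lemma xOh_mem {t : ℤ} {f} (hf : f ∈ xMt F n t) (h : Dual F (KV₁ F n))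
    (hh : h (Pi.single (Fin.last n) 1) = 0) : xOh F n h f ∈ xMt F n (t + 1) := by
  rw [xOh, LinearMap.sum_apply]
  refine Submodule.sum_mem _ fun j _ => ?_
  by_cases hj : j = Fin.last n
  · rw [hj, hh]; simp
  · exact Submodule.smul_mem _ _ (xO_mem F n hf j hj)

/-- The operator of right multiplication by `τ`. -/
def xT : XM F n →ₗ[F] XM F n :=
  ∑ i : Fin n, xE F n (LinearMap.proj i) ∘ₗ xO F n i.castSucc

lemma xT_single (a w) : xT F n (Finsupp.single a w) =
    ∑ i : Fin n, Finsupp.single (a + Finsupp.single i.castSucc 1)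
      (xinv F n w * xi F n (LinearMap.proj i)) := by
  simp only [xT, LinearMap.sum_apply, LinearMap.comp_apply, xO_single, xE_single]

lemma xT_mem {t : ℤ} {f} (hf : f ∈ xMt F n t) : xT F n f ∈ xMt F n (t + 2) := by
  rw [xT, LinearMap.sum_apply]
  refine Submodule.sum_mem _ fun j _ => ?_
  have := xE_mem F n (xO_mem F n hf j.castSucc (Fin.castSucc_lt_last j).ne) (LinearMap.proj j)
  rwa [add_assoc] at this

/-- The homotopy. -/
def xh : XM F n →ₗ[F] XM F n :=
  Finsupp.lsum F fun a => ∑ i : Fin n, (a i.castSucc : F) •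
    (Finsupp.lsingle (a - Finsupp.single i.castSucc 1) ∘ₗ xC F n i ∘ₗ xinv F n)

lemma xh_single (a w) : xh F n (Finsupp.single a w) =
    ∑ i : Fin n, (a i.castSucc : F) • Finsupp.single (a - Finsupp.single i.castSucc 1)
      (xC F n i (xinv F n w)) := by
  simp [xh]

lemma xh_mem {t : ℤ} {f} (hf : f ∈ xMt F n t) : xh F n f ∈ xMt F n (t - 2) := by
  refine xMt_ind F n ((xMt F n (t - 2)).comap (xh F n)) ?_ hf
  intro a w ha hw
  rw [Submodule.mem_comap, xh_single]
  refine Submodule.sum_mem _ fun i _ => ?_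
  by_cases h : a i.castSucc = 0
  · rw [h]; simp
  · refine Submodule.smul_mem _ _ (single_mem F n ?_ ?_)
    · simp [ha]
    · have h2 : (a - Finsupp.single i.castSucc 1) + Finsupp.single i.castSucc 1 = a := by
        apply tsub_add_cancel_of_le
        rw [Finsupp.single_le_iff]; omega
      have h3 := congrArg Finsupp.degree h2
      rw [map_add, Finsupp.degree_single] at h3
      have := xC_mem F n i (xinv_mem F n hw)
      convert this using 2
      have h4 : ((a - Finsupp.single i.castSucc 1).degree : ℤ) + 1 = a.degree := by exact_mod_cast h3
      linarith

lemma exp_key (a : Fin (n + 1) →₀ ℕ) (i j : Fin n) (w : XL F n) :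
    (((a + Finsupp.single i.castSucc 1 : Fin (n + 1) →₀ ℕ) j.castSucc : ℕ) : F) •
      Finsupp.single (a + Finsupp.single i.castSucc 1 - Finsupp.single j.castSucc 1) w =
    (a j.castSucc : F) •
      Finsupp.single (a - Finsupp.single j.castSucc 1 + Finsupp.single i.castSucc 1) w +
    (if i = j then Finsupp.single a w else 0) := by
  by_cases hij : i = j
  · subst hij
    simp only [if_true, add_tsub_cancel_right, Finsupp.add_apply, Finsupp.single_eq_same]
    push_cast
    rw [add_smul, one_smul]
    by_cases h : a i.castSucc = 0
    · simp [h]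
    · rw [tsub_add_cancel_of_le]
      rw [Finsupp.single_le_iff]; omega
  · have h1 : i.castSucc ≠ j.castSucc := fun h => hij (Fin.castSucc_injective n h)
    simp only [hij, if_false, add_zero, Finsupp.add_apply, Finsupp.single_apply, h1]
    by_cases h : a j.castSucc = 0
    · simp [h]
    · congr 2
      ext k
      simp only [Finsupp.coe_add, Finsupp.coe_tsub, Pi.add_apply, Pi.sub_apply, Finsupp.single_apply]
      split_ifs <;> subst_vars <;> omega

lemma lap {k : ℤ} {a : Fin (n + 1) →₀ ℕ} {w} (ha : a (Fin.last n) = 0) (hw : w ∈ xG F n k) :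
    xT F n (xh F n (Finsupp.single a w)) + xh F n (xT F n (Finsupp.single a w)) =
      (-((a.degree : F) + n - k)) • Finsupp.single a w := by
  have hdeg : (a.degree : F) = ∑ i : Fin n, (a i.castSucc : F) := by
    rw [Finsupp.degree_eq_sum, Fin.sum_univ_castSucc, ha]
    simp
  have e1 : xT F n (xh F n (Finsupp.single a w)) = - ∑ i : Fin n, ∑ j : Fin n,
      (a j.castSucc : F) •
      Finsupp.single (a - Finsupp.single j.castSucc 1 + Finsupp.single i.castSucc 1)
        (xC F n j w * xi F n (LinearMap.proj i)) := by
    rw [xh_single, map_sum, Finset.sum_comm, ← Finset.sum_neg_distrib]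
    refine Finset.sum_congr rfl fun j _ => ?_
    rw [map_smul, xT_single, Finset.smul_sum, ← Finset.sum_neg_distrib]
    refine Finset.sum_congr rfl fun i _ => ?_
    rw [xinv_xC, xinv_xinv, neg_mul, Finsupp.single_neg, smul_neg]
  have e2 : xh F n (xT F n (Finsupp.single a w)) = - ∑ i : Fin n, ∑ j : Fin n,
      (((a + Finsupp.single i.castSucc 1 : Fin (n + 1) →₀ ℕ) j.castSucc : ℕ) : F) •
      Finsupp.single (a + Finsupp.single i.castSucc 1 - Finsupp.single j.castSucc 1)
        ((if i = j then w else 0) - xC F n j w * xi F n (LinearMap.proj i)) := by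
    rw [xT_single, map_sum, ← Finset.sum_neg_distrib]
    refine Finset.sum_congr rfl fun i _ => ?_
    rw [xh_single, ← Finset.sum_neg_distrib]
    refine Finset.sum_congr rfl fun j _ => ?_
    rw [xinv_mul, xinv_xinv, xinv_xi, mul_neg, map_neg, xC_mul, Finsupp.single_neg, smul_neg]
    congr 4
    simp [Pi.single_apply]
  have e3 : ∀ i j : Fin n, (((a + Finsupp.single i.castSucc 1 : Fin (n + 1) →₀ ℕ) j.castSucc : ℕ) : F) •
      Finsupp.single (a + Finsupp.single i.castSucc 1 - Finsupp.single j.castSucc 1)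
        ((if i = j then w else 0) - xC F n j w * xi F n (LinearMap.proj i)) =
      (if i = j then ((a i.castSucc : F) + 1) • Finsupp.single a w else 0) -
      ((a j.castSucc : F) •
      Finsupp.single (a - Finsupp.single j.castSucc 1 + Finsupp.single i.castSucc 1)
        (xC F n j w * xi F n (LinearMap.proj i)) +
      (if i = j then Finsupp.single a (xC F n j w * xi F n (LinearMap.proj i)) else 0)) := by
    intro i j
    rw [Finsupp.single_sub, smul_sub, exp_key F n a i j (xC F n j w * xi F n (LinearMap.proj i))]
    congr 1
    by_cases hij : i = j
    · subst hij
      simp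
    · simp [hij]
  rw [e1, e2]
  simp only [e3, Finset.sum_sub_distrib, Finset.sum_add_distrib, Finset.sum_ite_eq,
    Finset.mem_univ, if_true]
  rw [← Finset.sum_smul, Finset.sum_add_distrib, ← hdeg]
  have e4 : ∑ i : Fin n, Finsupp.single a (xC F n i w * xi F n (LinearMap.proj i)) =
      (k : F) • Finsupp.single a w := by
    rw [Finsupp.smul_single, ← xN F n hw]
    exact (map_sum (Finsupp.singleAddHom a) _ _).symm
  rw [e4]
  simp only [Finset.sum_const, Finset.card_univ, Fintype.card_fin, nsmul_eq_mul, mul_one, neg_smul,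
    sub_smul, add_smul]
  abel

lemma xT_xT [CharZero F] (f) : xT F n (xT F n f) = 0 := by
  induction f using Finsupp.induction_linear with
  | zero => simp
  | add f g hf hg => simp only [map_add, hf, hg, add_zero]
  | single a w =>
    have e1 : xT F n (xT F n (Finsupp.single a w)) = ∑ i : Fin n, ∑ j : Fin n,
      Finsupp.single (a + Finsupp.single i.castSucc 1 + Finsupp.single j.castSucc 1)
        (- (w * (xi F n (LinearMap.proj i) * xi F n (LinearMap.proj j)))) := by
      rw [xT_single, map_sum]
      refine Finset.sum_congr rfl fun i _ => ?_
      rw [xT_single]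
      refine Finset.sum_congr rfl fun j _ => ?_
      rw [xinv_mul, xinv_xinv, xinv_xi, mul_neg, neg_mul, mul_assoc]
    have e2 : xT F n (xT F n (Finsupp.single a w)) = - xT F n (xT F n (Finsupp.single a w)) := by
      conv_lhs => rw [e1, Finset.sum_comm]
      conv_rhs => rw [e1, ← Finset.sum_neg_distrib]
      refine Finset.sum_congr rfl fun i _ => ?_
      rw [← Finset.sum_neg_distrib]
      refine Finset.sum_congr rfl fun j _ => ?_
      rw [xi_anti, mul_neg, add_right_comm, ← Finsupp.single_neg]
    rw [eq_neg_iff_add_eq_zero, ← two_smul F] at e2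
    exact (smul_eq_zero.mp e2).resolve_left two_ne_zero

/-! ### Dimensions -/

lemma finrank_map_add {V W : Type} [AddCommGroup V] [Module F V] [AddCommGroup W] [Module F W]
    (p : Submodule F V) [Module.Finite F p] (f : V →ₗ[F] W) :
    Module.finrank F (p.map f) + Module.finrank F (p ⊓ LinearMap.ker f : Submodule F V) =
      Module.finrank F p := by
  have h := LinearMap.finrank_range_add_finrank_ker (f.domRestrict p)
  have h1 : LinearMap.range (f.domRestrict p) = p.map f := by
    rw [LinearMap.domRestrict, LinearMap.range_comp, Submodule.range_subtype]
  have h2 : (LinearMap.ker (f.domRestrict p)).map p.subtype = p ⊓ LinearMap.ker f := by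
    rw [LinearMap.domRestrict, LinearMap.ker_comp, Submodule.map_comap_subtype]
  rw [h1] at h
  rw [← h2, ← (Submodule.equivMapOfInjective p.subtype p.injective_subtype _).finrank_eq]
  exact h

/-- Exponents of degree at most `t`. -/
def xA (t : ℕ) : Finset (Fin (n + 1) →₀ ℕ) :=
  (Finset.range (t + 1)).biUnion fun p =>
    Finset.finsuppAntidiag (Finset.univ.erase (Fin.last n)) p

lemma mem_antidiag (a : Fin (n + 1) →₀ ℕ) (p : ℕ) :
    a ∈ Finset.finsuppAntidiag (Finset.univ.erase (Fin.last n)) p ↔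
      a.degree = p ∧ a (Fin.last n) = 0 := by
  rw [Finset.mem_finsuppAntidiag, Finsupp.degree_eq_sum]
  have key : a.support ⊆ Finset.univ.erase (Fin.last n) ↔ a (Fin.last n) = 0 := by
    constructor
    · intro h
      by_contra h0
      have := h (Finsupp.mem_support_iff.mpr h0)
      simp at this
    · intro h i hi
      simp only [Finset.mem_erase, Finset.mem_univ, and_true]
      rintro rfl
      exact Finsupp.mem_support_iff.mp hi h
  rw [key]
  refine and_congr_left fun h => ?_
  rw [← Finset.add_sum_erase _ _ (Finset.mem_univ (Fin.last n)), h, zero_add]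

lemma mem_xA (t : ℕ) (a) : a ∈ xA n t ↔ a.degree ≤ t ∧ a (Fin.last n) = 0 := by
  simp only [xA, Finset.mem_biUnion, mem_antidiag, Finset.mem_range]
  constructor
  · rintro ⟨p, hp, rfl, h⟩; exact ⟨by omega, h⟩
  · rintro ⟨h1, h2⟩; exact ⟨_, by omega, rfl, h2⟩

/-- Coordinates on the degree `t` part. -/
def xcoord (t : ℕ) : xMt F n t →ₗ[F] (∀ a : xA n t, xG F n ((t : ℤ) - a.1.degree)) where
  toFun f a := ⟨f.1 a.1, (f.2 a.1).1⟩
  map_add' f g := rfl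
  map_smul' c f := rfl

lemma xcoord_bij (t : ℕ) : Function.Bijective (xcoord F n t) := by
  constructor
  · intro f g hfg
    ext1
    ext1 a
    by_cases ha : a ∈ xA n t
    · exact congrArg Subtype.val (congrFun hfg ⟨a, ha⟩)
    · rw [mem_xA, not_and_or] at ha
      have key : ∀ f : xMt F n t, f.1 a = 0 := by
        intro f
        rcases ha with ha | ha
        · have := (f.2 a).1
          rw [xG_neg F n (by omega)] at this
          exact (Submodule.mem_bot F).mp this
        · exact (f.2 a).2 ha
      rw [key f, key g]
  · intro g
    classical
    refine ⟨⟨∑ a : xA n t, Finsupp.single a.1 (g a).1, Submodule.sum_mem _ fun a _ =>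
      single_mem F n ((mem_xA n t _).mp a.2).2 (g a).2⟩, ?_⟩
    funext a
    ext1
    change (∑ a : xA n t, Finsupp.single a.1 (g a).1) a.1 = _
    rw [Finsupp.finset_sum_apply, Finset.sum_eq_single a]
    · simp
    · intro b _ hb
      rw [Finsupp.single_apply, if_neg]
      exact fun h => hb (Subtype.ext h)
    · simp

lemma xMt_neg {t : ℤ} (ht : t < 0) : xMt F n t = ⊥ := by
  rw [eq_bot_iff]
  intro f hf
  rw [Submodule.mem_bot]
  ext1 a
  have := (hf a).1
  rw [xG_neg F n (by omega)] at this
  exact (Submodule.mem_bot F).mp this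

lemma xMt_finite (t : ℤ) : Module.Finite F (xMt F n t) := by
  rcases lt_or_ge t 0 with ht | ht
  · rw [xMt_neg F n ht]; infer_instance
  · lift t to ℕ using ht
    have := fun k => xG_finite F n k
    exact Module.Finite.equiv (LinearEquiv.ofBijective _ (xcoord_bij F n t)).symm

lemma xMt_finrank (t : ℕ) : Module.finrank F (xMt F n t) = dimHn n t := by
  have := fun k => xG_finite F n k
  rw [(LinearEquiv.ofBijective _ (xcoord_bij F n t)).finrank_eq, Module.finrank_pi_fintype]
  have h1 : ∀ a : xA n t, Module.finrank F (xG F n ((t : ℤ) - a.1.degree)) =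
      n.choose (t - a.1.degree) := by
    intro a
    have := ((mem_xA n t _).mp a.2).1
    rw [← xG_finrank F n, Nat.cast_sub this]
  simp only [h1]
  rw [Finset.sum_coe_sort (xA n t) (fun a => n.choose (t - a.degree)), xA, Finset.sum_biUnion]
  · rw [dimHn]
    refine Finset.sum_congr rfl fun p _ => ?_
    rw [Finset.sum_congr rfl (g := fun _ => n.choose (t - p))
      (fun a ha => by rw [((mem_antidiag n a p).mp ha).1])]
    rw [Finset.sum_const, Finset.card_finsuppAntidiag_nat_eq_multichoose, Nat.multichoose_eq]
    simp [mul_comm]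
  · intro p _ q _ hpq
    rw [Function.onFun, Finset.disjoint_left]
    intro a ha hb
    rw [mem_antidiag] at ha hb
    exact hpq (ha.1.symm.trans hb.1)

/-- The Laplacian. -/
def xL : XM F n →ₗ[F] XM F n := xT F n ∘ₗ xh F n + xh F n ∘ₗ xT F n

lemma xL_apply {t : ℤ} {f} (hf : f ∈ xMt F n t) (b) :
    xL F n f b = (-((2 * b.degree + n - t : ℤ) : F)) • f b := by
  let S : Submodule F (XM F n) := LinearMap.ker
    (Finsupp.lapply b ∘ₗ xL F n - (-((2 * b.degree + n - t : ℤ) : F)) • Finsupp.lapply b)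
  have hS : xMt F n t ≤ S := by
    refine xMt_ind F n S ?_
    intro a w ha hw
    simp only [S, LinearMap.mem_ker, LinearMap.sub_apply, LinearMap.comp_apply,
      LinearMap.smul_apply, Finsupp.lapply_apply]
    rw [xL, LinearMap.add_apply, LinearMap.comp_apply, LinearMap.comp_apply, lap F n ha hw,
      Finsupp.smul_apply, Finsupp.single_apply]
    split_ifs with h
    · subst h
      rw [← sub_smul]
      push_cast
      ring_nf
      simp
    · simp
  have := hS hf
  simp only [S, LinearMap.mem_ker, LinearMap.sub_apply, LinearMap.comp_apply,
      LinearMap.smul_apply, Finsupp.lapply_apply] at this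
  exact sub_eq_zero.mp this

/-- The kernel of `T` in degree `t`. -/
def xK (t : ℤ) : Submodule F (XM F n) := xMt F n t ⊓ LinearMap.ker (xT F n)

lemma xT_zero (f) : xT F n f 0 = 0 := by
  induction f using Finsupp.induction_linear with
  | zero => simp
  | add f g hf hg => rw [map_add, Finsupp.add_apply, hf, hg, add_zero]
  | single a w =>
    rw [xT_single, Finsupp.finset_sum_apply]
    refine Finset.sum_eq_zero fun i _ => ?_
    rw [Finsupp.single_apply, if_neg]
    intro h
    have := DFunLike.congr_fun h i.castSucc
    simp at this

section
variable [CharZero F]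

lemma xW_apply {t : ℤ} {f} (hf : f ∈ xMt F n t) (hL : xL F n f = 0) (a) (h : a ≠ 0 ∨ t ≠ n) :
    f a = 0 := by
  have h1 := xL_apply F n hf a
  rw [hL, Finsupp.zero_apply] at h1
  rcases smul_eq_zero.mp h1.symm with h2 | h2
  · rw [neg_eq_zero, Int.cast_eq_zero] at h2
    have h3 : a ≠ 0 := by
      rcases h with h | h
      · exact h
      · rintro rfl
        simp at h2
        omega
    have h4 : a.degree ≠ 0 := by
      rwa [Ne, Finsupp.degree_eq_zero_iff]
    have h5 := (hf a).1
    rw [xG_big F n (by omega)] at h5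
    exact (Submodule.mem_bot F).mp h5
  · exact h2

lemma xW_finrank (t : ℤ) : Module.finrank F (xK F n t ⊓ LinearMap.ker (xL F n) : Submodule F (XM F n)) =
    if t = n then 1 else 0 := by
  split_ifs with h
  · have e : (xK F n t ⊓ LinearMap.ker (xL F n) : Submodule F (XM F n)) =
        (xG F n n).map (Finsupp.lsingle 0) := by
      apply le_antisymm
      · rintro f ⟨⟨hf, -⟩, hL⟩
        refine ⟨f 0, ?_, ?_⟩
        · have := (hf 0).1
          simpa [h] using this
        · ext1 a
          rw [Finsupp.lsingle_apply, Finsupp.single_apply]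
          split_ifs with ha
          · rw [ha]
          · exact (xW_apply F n hf hL a (Or.inl (Ne.symm ha))).symm
      · rintro _ ⟨w, hw, rfl⟩
        have hm : Finsupp.single 0 w ∈ xMt F n t := by
          apply single_mem F n (by simp)
          simpa [h] using hw
        have hT : xT F n (Finsupp.single 0 w) = 0 := by
          rw [xT_single]
          refine Finset.sum_eq_zero fun i _ => ?_
          have := xG_xi F n (xinv_mem F n hw) (LinearMap.proj i)
          rw [xG_big F n (by omega)] at this
          rw [(Submodule.mem_bot F).mp this, Finsupp.single_zero]
        refine ⟨⟨hm, hT⟩, ?_⟩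
        change xL F n (Finsupp.single 0 w) = 0
        ext1 a
        change xL F n (Finsupp.single 0 w) a = 0
        rw [xL_apply F n hm, Finsupp.single_apply]
        split_ifs with ha
        · subst ha; simp [h]
        · simp
    rw [e, ← (Submodule.equivMapOfInjective (Finsupp.lsingle 0)
      (Finsupp.single_injective 0) _).finrank_eq, xG_finrank, Nat.choose_self]
  · have e : (xK F n t ⊓ LinearMap.ker (xL F n) : Submodule F (XM F n)) = ⊥ := by
      rw [eq_bot_iff]
      rintro f ⟨⟨hf, -⟩, hL⟩
      rw [Submodule.mem_bot]
      ext1 a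
      exact xW_apply F n hf hL a (Or.inr h)
    rw [e, finrank_bot]

lemma xK_finrank (t : ℤ) : Module.finrank F (xK F n t) =
    Module.finrank F ((xMt F n (t - 2)).map (xT F n)) + if t = n then 1 else 0 := by
  have f1 := xMt_finite F n t
  have f2 := xMt_finite F n (t - 2)
  have f3 : Module.Finite F (xK F n t) := Submodule.finiteDimensional_of_le inf_le_left
  have h := finrank_map_add F (xK F n t) (xL F n)
  rw [xW_finrank] at h
  have h1 : (xK F n t).map (xL F n) ≤ (xMt F n (t - 2)).map (xT F n) := by
    rintro _ ⟨f, ⟨hf, hT⟩, rfl⟩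
    refine ⟨xh F n f, xh_mem F n hf, ?_⟩
    rw [SetLike.mem_coe, LinearMap.mem_ker] at hT
    simp [xL, hT]
  have h2 : (xMt F n (t - 2)).map (xT F n) ≤ xK F n t := by
    rintro _ ⟨f, hf, rfl⟩
    refine ⟨?_, xT_xT F n f⟩
    have := xT_mem F n hf
    rwa [sub_add_cancel] at this
  have h3 : (xMt F n (t - 2)).map (xT F n) ⊓ (xK F n t ⊓ LinearMap.ker (xL F n)) = ⊥ := by
    rw [eq_bot_iff]
    rintro _ ⟨⟨f, hf, rfl⟩, ⟨⟨hm, -⟩, hL⟩⟩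
    rw [Submodule.mem_bot]
    ext1 a
    by_cases ha : a = 0
    · rw [ha, xT_zero]; rfl
    · exact xW_apply F n hm hL a (Or.inl ha)
  have f4 : Module.Finite F (xK F n t ⊓ LinearMap.ker (xL F n) : Submodule F (XM F n)) :=
    Submodule.finiteDimensional_of_le inf_le_left
  have h4 := Submodule.finrank_sup_add_finrank_inf_eq ((xMt F n (t - 2)).map (xT F n))
    (xK F n t ⊓ LinearMap.ker (xL F n))
  rw [h3, finrank_bot, add_zero, xW_finrank] at h4
  have h5 := Submodule.finrank_mono (sup_le h2
    (inf_le_left : xK F n t ⊓ LinearMap.ker (xL F n) ≤ xK F n t))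
  have h6 := Submodule.finrank_mono h1
  omega

lemma xK_rec (t : ℤ) : Module.finrank F (xK F n t) + Module.finrank F (xK F n (t - 2)) =
    Module.finrank F (xMt F n (t - 2)) + if t = n then 1 else 0 := by
  have f2 := xMt_finite F n (t - 2)
  have h := finrank_map_add F (xMt F n (t - 2)) (xT F n)
  rw [xK_finrank]
  change _ + Module.finrank F (xK F n (t - 2)) = _ at h
  omega

lemma xK_neg {t : ℤ} (ht : t < 0) : Module.finrank F (xK F n t) = 0 := by
  rw [xK, xMt_neg F n ht, bot_inf_eq, finrank_bot]

lemma xK_formula (t : ℕ) : (Module.finrank F (xK F n t) : ℤ) =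
      (∑ i ∈ Finset.Icc 1 (t / 2),
        (-1 : ℤ) ^ (i - 1) * ((dimHn n (t - 2 * i) : ℤ) - (if t - 2 * i = n then 1 else 0))) +
        (if t = n then 1 else 0) := by
  induction t using Nat.strong_induction_on with
  | _ t ih =>
    have hr := xK_rec F n t
    simp only [Nat.cast_inj] at hr
    rcases lt_or_ge t 2 with ht | ht
    · rw [xK_neg F n (t := (t : ℤ) - 2) (by omega), xMt_neg F n (t := (t : ℤ) - 2) (by omega)] at hr
      simp only [finrank_bot, add_zero, zero_add] at hr
      rw [hr, Nat.div_eq_of_lt ht]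
      simp
    · obtain ⟨s, rfl⟩ := Nat.exists_eq_add_of_le' ht
      have e : ((s + 2 : ℕ) : ℤ) - 2 = s := by push_cast; ring
      rw [e, xMt_finrank] at hr
      have ih' := ih s (by omega)
      have hs : (s + 2) / 2 = s / 2 + 1 := by omega
      rw [hs, ← Finset.add_sum_Ioc_eq_sum_Icc (by omega)]
      have h7 : ∑ i ∈ Finset.Ioc 1 (s / 2 + 1),
          (-1 : ℤ) ^ (i - 1) * ((dimHn n (s + 2 - 2 * i) : ℤ) - (if s + 2 - 2 * i = n then 1 else 0))
          = - ∑ i ∈ Finset.Icc 1 (s / 2),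
          (-1 : ℤ) ^ (i - 1) * ((dimHn n (s - 2 * i) : ℤ) - (if s - 2 * i = n then 1 else 0)) := by
        rw [← Finset.sum_neg_distrib]
        symm
        refine Finset.sum_bij (fun i _ => i + 1) ?_ ?_ ?_ ?_
        · intro i hi; simp only [Finset.mem_Icc, Finset.mem_Ioc] at *; omega
        · intro i _ j _ h; omega
        · intro j hj
          simp only [Finset.mem_Ioc] at hj
          exact ⟨j - 1, by simp only [Finset.mem_Icc]; omega, by omega⟩
        · intro i hi
          simp only [Finset.mem_Icc] at hi
          obtain ⟨k, rfl⟩ := Nat.exists_eq_add_of_le' hi.1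
          rw [show s + 2 - 2 * (k + 1 + 1) = s - 2 * (k + 1) by omega]
          simp only [Nat.add_sub_cancel, pow_succ]
          ring
      rw [h7]
      have hr' : (Module.finrank F (xK F n ((s + 2 : ℕ) : ℤ)) : ℤ) + Module.finrank F (xK F n s) =
        dimHn n s + if s + 2 = n then 1 else 0 := by exact_mod_cast hr
      simp only [mul_one, Nat.add_sub_cancel, Nat.sub_self, pow_zero, one_mul]
      linarith

/-! ### Transfer to the cochain algebra -/

/-- The linear equivalence with the model. -/
def xe : KC F n ≃ₗ[F] XM F n :=
  LinearEquiv.ofLinear (xphi F n) (xpsi F n)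
    (LinearMap.ext (xphi_xpsi F n)) (LinearMap.ext (xpsi_xphi F n))

lemma Hn_gE {q : ℕ} {x} (hx : x ∈ Hn F n q) (u) : x * gE F n u ∈ Hn F n (q + 1) := by
  have : Hn F n q ≤ (Hn F n (q + 1)).comap (LinearMap.mulRight F (gE F n u)) := by
    rw [Hn, Submodule.span_le]
    rintro _ ⟨l, h1, h2, rfl⟩
    refine Submodule.subset_span ⟨l ++ [Sum.inl u], by simp [h1], ?_, by simp [mon]⟩
    intro h hh
    exact h2 h (by simpa using hh)
  exact this hx

lemma Hn_gj {q : ℕ} {x} (hx : x ∈ Hn F n q) (j : Fin (n + 1)) (hj : j ≠ Fin.last n) :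
    x * gj F n j ∈ Hn F n (q + 1) := by
  have : Hn F n q ≤ (Hn F n (q + 1)).comap (LinearMap.mulRight F (gj F n j)) := by
    rw [Hn, Submodule.span_le]
    rintro _ ⟨l, h1, h2, rfl⟩
    refine Submodule.subset_span ⟨l ++ [Sum.inr (LinearMap.proj j)], by simp [h1], ?_,
      by simp [mon, gj]⟩
    intro h hh
    simp only [List.mem_append, List.mem_singleton, Sum.inr.injEq] at hh
    rcases hh with hh | rfl
    · exact h2 h hh
    · simp [hj]
  exact this hx

lemma xP_mem (a : Fin (n + 1) →₀ ℕ) (ha : a (Fin.last n) = 0) : xP F n a ∈ Hn F n a.degree := by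
  induction a using exp_induction with
  | h0 =>
    rw [xP_zero]
    exact Submodule.subset_span ⟨[], by simp, by simp, by simp [mon]⟩
  | hs a j ih =>
    rw [Finsupp.add_apply, Nat.add_eq_zero_iff] at ha
    rw [xP_succ, map_add, Finsupp.degree_single]
    apply Hn_gj F n (ih ha.1)
    rintro rfl
    simp at ha

lemma mul_xlift_mem {q : ℕ} {x} (hx : x ∈ Hn F n q) {k : ℤ} {w} (hw : w ∈ xG F n k) :
    0 ≤ k → x * xlift F n w ∈ Hn F n (q + k.toNat) := by
  refine xG_ind F n (p := fun k w => 0 ≤ k → x * xlift F n w ∈ Hn F n (q + k.toNat)) ?_ ?_ ?_ ?_ hw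
  · intro k _; simp
  · intro c _
    rw [AlgHom.commutes, ← Algebra.commutes, ← Algebra.smul_def]
    exact Submodule.smul_mem _ _ (by simpa using hx)
  · intro k y z hy hz hk
    rw [map_add, mul_add]
    exact add_mem (hy hk) (hz hk)
  · intro k w u hw hp hk
    rcases lt_or_ge k 0 with h | h
    · rw [xG_neg F n h] at hw
      rw [(Submodule.mem_bot F).mp hw]
      simp
    · rw [map_mul, ← mul_assoc, xlift_xi]
      have := Hn_gE F n (hp h) u
      rwa [show q + (k + 1).toNat = q + k.toNat + 1 by omega]

lemma Hn_map (t : ℕ) : (Hn F n t).map (xphi F n) = xMt F n t := by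
  apply le_antisymm
  · rw [Submodule.map_le_iff_le_comap, Hn, Submodule.span_le]
    rintro _ ⟨l, rfl, h2, rfl⟩
    rw [SetLike.mem_coe, Submodule.mem_comap]
    induction l using List.reverseRecOn with
    | nil =>
      have : mon F (Dual F (KV₀ F n)) (Dual F (KV₁ F n)) [] = 1 := by simp [mon]
      rw [this]
      change xact F n 1 (Finsupp.single 0 1) ∈ _
      rw [xact_one]
      apply single_mem F n (by simp)
      have := xG_nat F n 0
      simp only [Nat.cast_zero] at this
      simp only [List.length_nil, Nat.cast_zero, map_zero, sub_zero]
      rw [this, ExteriorAlgebra.exteriorPower, pow_zero]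
      exact Submodule.one_le.mp le_rfl
    | append_singleton l x ih =>
      have ih' := ih fun h hh => h2 h (by simp [hh])
      have e : (((l ++ [x]).length : ℕ) : ℤ) = (l.length : ℤ) + 1 := by simp
      rw [e]
      cases x with
      | inl u =>
        have : mon F (Dual F (KV₀ F n)) (Dual F (KV₁ F n)) (l ++ [Sum.inl u]) =
          mon F (Dual F (KV₀ F n)) (Dual F (KV₁ F n)) l * gE F n u := by simp [mon]
        rw [this, xphi_mul, xact_gE]
        exact xE_mem F n ih' u
      | inr h =>
        have : mon F (Dual F (KV₀ F n)) (Dual F (KV₁ F n)) (l ++ [Sum.inr h]) =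
          mon F (Dual F (KV₀ F n)) (Dual F (KV₁ F n)) l * gO F n h := by simp [mon]
        rw [this, xphi_mul, xact_gO]
        exact xOh_mem F n ih' h (h2 h (by simp))
  · refine xMt_ind F n _ ?_
    intro a w ha hw
    rcases lt_or_ge ((t : ℤ) - a.degree) 0 with h | h
    · rw [xG_neg F n h] at hw
      rw [(Submodule.mem_bot F).mp hw]
      simp
    · refine ⟨xpsi F n (Finsupp.single a w), ?_, xphi_xpsi F n _⟩
      rw [xpsi_single]
      have := mul_xlift_mem F n (xP_mem F n a ha) hw h
      rwa [show a.degree + ((t : ℤ) - a.degree).toNat = t by omega] at this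

lemma xact_kTau (f) : xact F n (kTau F n) f = xT F n f := by
  have hs : ∀ (s : Finset (Fin n)), xact F n (∑ i ∈ s, kO F n i * kE F n i) f =
      ∑ i ∈ s, xact F n (kO F n i * kE F n i) f := by
    intro s
    have : ∀ x, xact F n x f = (LinearMap.applyₗ f ∘ₗ
      (MulOpposite.opLinearEquiv F).symm.toLinearMap ∘ₗ (xrho F n).toLinearMap) x := fun x => rfl
    simp only [this, map_sum]
  rw [kTau, hs, xT, LinearMap.sum_apply]
  refine Finset.sum_congr rfl fun i _ => ?_
  rw [xact_mul]
  change xact F n (gE F n _) (xact F n (gj F n _) f) = _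
  rw [xact_gE, xact_gj]
  rfl

lemma xO_inj (j) : Function.Injective (xO F n j) := by
  intro f g h
  have h1 := Finsupp.mapDomain_injective (f := fun a : Fin (n + 1) →₀ ℕ => a + Finsupp.single j 1)
    (fun a b hab => add_right_cancel hab) h
  refine Finsupp.mapRange_injective (xinv F n) (map_zero _) ?_ h1
  intro x y hxy
  rw [← xinv_xinv F n x, hxy, xinv_xinv]

lemma xact_kTauL (l : ℕ) (hl : 1 ≤ l) (f) : xact F n (kTauL F n l) f = 0 ↔ xT F n f = 0 := by
  rw [kTauL, xact_smul, xact_mul, xact_kTau]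
  have hinj : ∀ m : ℕ, ∀ g, xact F n (kZ F n ^ m) g = 0 ↔ g = 0 := by
    intro m
    induction m with
    | zero => intro g; rw [pow_zero, xact_one]
    | succ m ih =>
      intro g
      rw [pow_succ, xact_mul]
      change xact F n (gj F n _) _ = 0 ↔ _
      rw [xact_gj, map_eq_zero_iff _ (xO_inj F n _), ih]
  have hl' : (l : F) ≠ 0 := by
    rw [Nat.cast_ne_zero]; omega
  rw [smul_eq_zero, or_iff_right hl', hinj]

lemma Hn_ker_map (t l : ℕ) (hl : 1 ≤ l) :
    (Hn F n t ⊓ LinearMap.ker (LinearMap.mulRight F (kTauL F n l)) :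
          Submodule F (KC F n)).map (xe F n).toLinearMap = xK F n t := by
  have key : ∀ x, x ∈ LinearMap.ker (LinearMap.mulRight F (kTauL F n l)) ↔
      xT F n (xphi F n x) = 0 := by
    intro x
    rw [LinearMap.mem_ker, LinearMap.mulRight_apply, ← xact_kTauL F n l hl, ← xphi_mul]
    exact (map_eq_zero_iff (xe F n) (xe F n).injective).symm
  rw [xK, ← Hn_map]
  ext y
  constructor
  · rintro ⟨x, ⟨h1, h2⟩, rfl⟩
    exact ⟨⟨x, h1, rfl⟩, (key x).mp h2⟩
  · rintro ⟨⟨x, h1, rfl⟩, h2⟩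
    exact ⟨x, ⟨h1, (key x).mpr h2⟩, rfl⟩

end

theorem stmt11 [CharZero F] (n : ℕ) (hn : 1 ≤ n) (t l : ℕ) (hl : 1 ≤ l) :
    (Module.finrank F
        (Hn F n t ⊓ LinearMap.ker (LinearMap.mulRight F (kTauL F n l)) :
          Submodule F (KC F n)) : ℤ) =
      (∑ i ∈ Finset.Icc 1 (t / 2),
        (-1 : ℤ) ^ (i - 1) * ((dimHn n (t - 2 * i) : ℤ) - (if t - 2 * i = n then 1 else 0))) +
        (if t = n then 1 else 0) := by
  rw [← xK_formula F n t, ← Hn_ker_map F n t l hl]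
  rw [LinearEquiv.finrank_map_eq]
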